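/- (Maximum principle.) Let Q : ℝ³ × [0,∞) → 𝒬₀ be a classical solution of the relaxed Q-tensor flow satisfying the constancy-outside-a-compact-set condition, with initial data Q₀(x) = Q(x,0) taking values in 𝒩 for every x ∈ ℝ³. Then |Q(x,t)| ≤ √(2/3) s₊ for all x ∈ ℝ³ and all t ≥ 0. -/

import Mathlib

open Matrix Finset MeasureTheory

noncomputable section

abbrev Mat := Matrix (Fin 3) (Fin 3) ℝ
abbrev Vec3 := Fin 3 → ℝ

/-- Spatial partial derivative `∂_k f`. -/
def pd (k : Fin 3) (f : Vec3 → ℝ) : Vec3 → ℝ := fun x => fderiv ℝ f x (Pi.single k 1)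

/-- Spatial Laplacian `Δf = Σ_k ∂_k ∂_k f`. -/
def lap (f : Vec3 → ℝ) (x : Vec3) : ℝ := ∑ k : Fin 3, pd k (pd k f) x

/-- `|∇Q|²(x,t) = Σ_{k,i,j} (∂_k Q_{ij})²`. -/
def gradSq (Q : Vec3 → ℝ → Mat) (x : Vec3) (t : ℝ) : ℝ :=
  ∑ k : Fin 3, ∑ i : Fin 3, ∑ j : Fin 3, pd k (fun y => Q y t i j) x ^ 2

def frob (A B : Mat) : ℝ := ∑ i : Fin 3, ∑ j : Fin 3, A i j * B i j
def mnormSq (A : Mat) : ℝ := frob A A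
def sPlus (a b c : ℝ) : ℝ := (b + Real.sqrt (b ^ 2 + 24 * a * c)) / (4 * c)
def Jmap (a b c : ℝ) (Q : Mat) : Mat :=
  (a - c * mnormSq Q) • Q + b • (Q * Q) - (b / 3 * mnormSq Q) • (1 : Mat)
def fB (a b c : ℝ) (Q : Mat) : ℝ :=
  -(a / 2) * mnormSq Q - b / 3 * (Q * Q * Q).trace + c / 4 * mnormSq Q ^ 2
def ftB (a b c : ℝ) (Q : Mat) : ℝ :=
  fB a b c Q + a * sPlus a b c ^ 2 / 3 + 2 * b * sPlus a b c ^ 3 / 27 - c * sPlus a b c ^ 4 / 9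
def NSet (a b c : ℝ) : Set Mat :=
  {Q | ∃ n : Vec3, n ⬝ᵥ n = 1 ∧ Q = sPlus a b c • (vecMulVec n n - (1 / 3 : ℝ) • (1 : Mat))}

/-- `Q` is a classical solution of the relaxed Q-tensor flow
`∂ₜQ = (1/(εΓ)) J(Q) + (L₁/Γ) ΔQ` for times `t ∈ I`. -/
def IsSolution (a b c Γ L1 ε : ℝ) (Q : Vec3 → ℝ → Mat) (I : Set ℝ) : Prop :=
  (∀ i j : Fin 3, ContDiff ℝ (⊤ : ℕ∞) fun p : Vec3 × ℝ => Q p.1 p.2 i j) ∧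
    ∀ (x : Vec3), ∀ t ∈ I, ∀ i j : Fin 3,
      deriv (fun s => Q x s i j) t =
        1 / (ε * Γ) * Jmap a b c (Q x t) i j + L1 / Γ * lap (fun y => Q y t i j) x

/-- Constancy outside a compact set: `Q(x,t) = A ∈ 𝒩` for `x` outside a compact set `K`. -/
def ConstOutside (a b c : ℝ) (Q : Vec3 → ℝ → Mat) (I : Set ℝ) : Prop :=
  ∃ A ∈ NSet a b c, ∃ K : Set Vec3, IsCompact K ∧ ∀ x ∉ K, ∀ t ∈ I, Q x t = A

/-- The energy density `e_ε(Q,∇Q) = f̃_B(Q)/(εΓ) + (L₁/(2Γ))|∇Q|²`. -/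
def eDens (a b c Γ L1 ε : ℝ) (Q : Vec3 → ℝ → Mat) (x : Vec3) (t : ℝ) : ℝ :=
  ftB a b c (Q x t) / (ε * Γ) + L1 / (2 * Γ) * gradSq Q x t

/-- The scaled backward heat kernel `G_{z₀}(x,t)`. -/
def Gk (Γ L1 : ℝ) (x₀ : Vec3) (t₀ : ℝ) (x : Vec3) (t : ℝ) : ℝ :=
  (4 * Real.pi * (L1 / Γ) * (t₀ - t)) ^ (-(3 : ℝ) / 2) *
    Real.exp (-(∑ i : Fin 3, (x i - x₀ i) ^ 2) / (4 * (L1 / Γ) * (t₀ - t)))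

/-- Second-order necessary condition at a local maximum. -/
theorem deriv_deriv_nonpos_of_isLocalMax {g : ℝ → ℝ} {x : ℝ} (hg : ContinuousAt g x)
    (h : IsLocalMax g x) : deriv (deriv g) x ≤ 0 := by
  by_contra! hpos
  have hmin := isLocalMin_of_deriv_deriv_pos hpos h.deriv_eq_zero hg
  have heq : g =ᶠ[nhds x] fun _ => g x := by
    filter_upwards [h, hmin] with y h1 h2 using le_antisymm h1 h2
  have h2 : deriv (deriv g) x = 0 := by
    rw [heq.deriv.deriv_eq]
    simp
  exact hpos.ne' h2

theorem hasDerivAt_comp_line {f : Vec3 → ℝ} (hf : Differentiable ℝ f) (x : Vec3) (k : Fin 3)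
    (s : ℝ) :
    HasDerivAt (fun s : ℝ => f (x + s • Pi.single k 1)) (pd k f (x + s • Pi.single k 1)) s := by
  have h1 : HasDerivAt (fun s : ℝ => x + s • (Pi.single k 1 : Vec3)) (Pi.single k 1) s := by
    simpa using ((hasDerivAt_id s).smul_const (Pi.single k 1 : Vec3)).const_add x
  exact (hf _).hasFDerivAt.comp_hasDerivAt s h1

theorem contDiff_pd {f : Vec3 → ℝ} (hf : ContDiff ℝ (⊤ : ℕ∞) f) (k : Fin 3) :
    ContDiff ℝ (⊤ : ℕ∞) (pd k f) :=
  (hf.fderiv_right (m := (⊤ : ℕ∞)) (by norm_cast)).clm_apply contDiff_const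

theorem differentiable_of_smooth {E : Type*} [NormedAddCommGroup E] [NormedSpace ℝ E] {f : E → ℝ}
    (hf : ContDiff ℝ (⊤ : ℕ∞) f) : Differentiable ℝ f :=
  hf.differentiable (by simp)

theorem lap_add {f g : Vec3 → ℝ} (hf : ContDiff ℝ (⊤ : ℕ∞) f) (hg : ContDiff ℝ (⊤ : ℕ∞) g)
    (x : Vec3) : lap (fun y => f y + g y) x = lap f x + lap g x := by
  have key : ∀ {f g : Vec3 → ℝ}, ContDiff ℝ (⊤ : ℕ∞) f → ContDiff ℝ (⊤ : ℕ∞) g →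
      ∀ k, pd k (fun y => f y + g y) = fun y => pd k f y + pd k g y := by
    intro f g hf hg k
    funext y
    simp only [pd]
    rw [fderiv_fun_add (differentiable_of_smooth hf y) (differentiable_of_smooth hg y)]
    rfl
  simp only [lap, key hf hg, key (contDiff_pd hf _) (contDiff_pd hg _), Finset.sum_add_distrib]

theorem lap_sub {f g : Vec3 → ℝ} (hf : ContDiff ℝ (⊤ : ℕ∞) f) (hg : ContDiff ℝ (⊤ : ℕ∞) g)
    (x : Vec3) : lap (fun y => f y - g y) x = lap f x - lap g x := by
  have key : ∀ {f g : Vec3 → ℝ}, ContDiff ℝ (⊤ : ℕ∞) f → ContDiff ℝ (⊤ : ℕ∞) g →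
      ∀ k, pd k (fun y => f y - g y) = fun y => pd k f y - pd k g y := by
    intro f g hf hg k
    funext y
    simp only [pd]
    rw [fderiv_fun_sub (differentiable_of_smooth hf y) (differentiable_of_smooth hg y)]
    rfl
  simp only [lap, key hf hg, key (contDiff_pd hf _) (contDiff_pd hg _), Finset.sum_sub_distrib]

/-- At a spatial maximum of `Σ fᵢ²` one has `Σ fᵢ Δfᵢ ≤ 0`. -/
theorem sum_mul_lap_nonpos_of_max {ι : Type*} [Fintype ι] {f : ι → Vec3 → ℝ}
    (hf : ∀ i, ContDiff ℝ (⊤ : ℕ∞) (f i)) (x : Vec3)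
    (hmax : ∀ y, ∑ i, f i y ^ 2 ≤ ∑ i, f i x ^ 2) : ∑ i, f i x * lap (f i) x ≤ 0 := by
  have hk : ∀ k, ∑ i, f i x * pd k (pd k (f i)) x ≤ 0 := by
    intro k
    have hd : ∀ i s, HasDerivAt (fun s : ℝ => f i (x + s • Pi.single k 1))
        (pd k (f i) (x + s • Pi.single k 1)) s := fun i s =>
      hasDerivAt_comp_line (differentiable_of_smooth (hf i)) x k s
    have hd2 : ∀ i s, HasDerivAt (fun s : ℝ => pd k (f i) (x + s • Pi.single k 1))
        (pd k (pd k (f i)) (x + s • Pi.single k 1)) s := fun i s =>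
      hasDerivAt_comp_line (differentiable_of_smooth (contDiff_pd (hf i) k)) x k s
    let g : ℝ → ℝ := fun s => ∑ i, f i (x + s • Pi.single k 1) ^ 2
    have hg1 : ∀ s, HasDerivAt g (∑ i, 2 * (f i (x + s • Pi.single k 1) *
        pd k (f i) (x + s • Pi.single k 1))) s := by
      intro s
      refine HasDerivAt.fun_sum fun i _ => ?_
      simpa [mul_assoc] using (hd i s).fun_pow 2
    have hg1' : deriv g = fun s => ∑ i, 2 * (f i (x + s • Pi.single k 1) *
        pd k (f i) (x + s • Pi.single k 1)) := funext fun s => (hg1 s).deriv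
    have hg2 : HasDerivAt (deriv g) (∑ i, 2 * (pd k (f i) x * pd k (f i) x +
        f i x * pd k (pd k (f i)) x)) 0 := by
      rw [hg1']
      refine HasDerivAt.fun_sum fun i _ => ?_
      simpa using ((hd i 0).fun_mul (hd2 i 0)).const_mul 2
    have hloc : IsLocalMax g 0 := Filter.Eventually.of_forall fun s => by
      simpa [g] using hmax (x + s • Pi.single k 1)
    have := deriv_deriv_nonpos_of_isLocalMax (hg1 0).continuousAt hloc
    rw [hg2.deriv, ← Finset.mul_sum, Finset.sum_add_distrib] at this
    have hsq : 0 ≤ ∑ i, pd k (f i) x * pd k (f i) x :=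
      Finset.sum_nonneg fun i _ => mul_self_nonneg _
    linarith
  simp only [lap, Finset.mul_sum]
  rw [Finset.sum_comm]
  exact Finset.sum_nonpos fun k _ => hk k

/-- A function on the line whose restriction to `[0, t]` is maximal at `t > 0` has nonnegative
derivative there. -/
theorem deriv_nonneg_of_max_left {g : ℝ → ℝ} {g' t : ℝ} (ht : 0 < t) (hg : HasDerivAt g g' t)
    (hmax : ∀ s ∈ Set.Icc 0 t, g s ≤ g t) : 0 ≤ g' := by
  have hloc : IsLocalMaxOn g (Set.Icc 0 t) t := by
    filter_upwards [self_mem_nhdsWithin] with s hs using hmax s hs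
  have hseg : segment ℝ t (t + -t) ⊆ Set.Icc 0 t := by
    rw [add_neg_cancel, segment_symm, segment_eq_Icc ht.le]
  have := hloc.hasFDerivWithinAt_nonpos hg.hasFDerivAt.hasFDerivWithinAt
    (mem_posTangentConeAt_of_segment_subset hseg)
  simp at this
  by_contra! hneg
  nlinarith

/-- Parabolic maximum principle for the squared norm of a vector-valued function. -/
theorem sum_sq_le_of_parabolic {ι : Type*} [Fintype ι] {f : ι → Vec3 → ℝ → ℝ}
    (hf : ∀ i, ContDiff ℝ (⊤ : ℕ∞) fun p : Vec3 × ℝ => f i p.1 p.2)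
    {K : Set Vec3} (hK : IsCompact K) {T κ C M : ℝ} (hκ : 0 < κ)
    (hout : ∀ x ∉ K, ∀ t, 0 ≤ t → ∑ i, f i x t ^ 2 ≤ M)
    (hinit : ∀ x, ∑ i, f i x 0 ^ 2 ≤ M)
    (hpde : ∀ x ∈ K, ∀ t ∈ Set.Ioc 0 T, M < ∑ i, f i x t ^ 2 →
      2 * ∑ i, f i x t * (deriv (fun s => f i x s) t - κ * lap (fun y => f i y t) x) ≤
        C * (∑ i, f i x t ^ 2 - M)) :
    ∀ x, ∀ t ∈ Set.Icc 0 T, ∑ i, f i x t ^ 2 ≤ M := by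
  intro x₁ t₁ ht₁
  by_contra! hlt
  have hx₁ : x₁ ∈ K := by
    by_contra hx
    exact absurd (hout x₁ hx t₁ ht₁.1) (not_le.mpr hlt)
  let v : Vec3 × ℝ → ℝ := fun p => Real.exp (-(C + 1) * p.2) * (∑ i, f i p.1 p.2 ^ 2 - M)
  have hv : Continuous v := by
    have := fun i => (hf i).continuous
    fun_prop
  obtain ⟨⟨x, t⟩, ⟨hx, ht⟩, hmax⟩ := (hK.prod (isCompact_Icc (a := (0 : ℝ)) (b := T))).exists_isMaxOn
    ⟨(x₁, t₁), hx₁, ht₁⟩ hv.continuousOn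
  simp only at hx ht
  have hv1 : 0 < v (x, t) := lt_of_lt_of_le
    (mul_pos (Real.exp_pos _) (sub_pos.mpr hlt)) (hmax (a := (x₁, t₁)) ⟨hx₁, ht₁⟩)
  have hu : M < ∑ i, f i x t ^ 2 := sub_pos.mp (pos_of_mul_pos_right hv1 (Real.exp_pos _).le)
  have ht0 : 0 < t := by
    refine lt_of_le_of_ne ht.1 ?_
    rintro rfl
    exact absurd (hinit x) (not_le.mpr hu)
  have hspace : ∀ y, ∑ i, f i y t ^ 2 ≤ ∑ i, f i x t ^ 2 := by
    intro y
    by_cases hy : y ∈ K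
    · have := hmax (a := (y, t)) ⟨hy, ht⟩
      have := le_of_mul_le_mul_left this (Real.exp_pos _)
      simpa using this
    · exact (hout y hy t ht.1).trans hu.le
  have hlap := sum_mul_lap_nonpos_of_max (f := fun i y => f i y t)
    (fun i => (hf i).comp (contDiff_id.prodMk contDiff_const)) x hspace
  have hdt : ∀ i, HasDerivAt (fun s => f i x s) (deriv (fun s => f i x s) t) t := fun i =>
    (differentiable_of_smooth (f := fun s => f i x s)
      ((hf i).comp (contDiff_const.prodMk contDiff_id)) t).hasDerivAt
  have hsum : HasDerivAt (fun s => ∑ i, f i x s ^ 2 - M)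
      (∑ i, 2 * (f i x t * deriv (fun s => f i x s) t)) t := by
    refine HasDerivAt.sub_const M (HasDerivAt.fun_sum fun i _ => ?_)
    simpa [mul_assoc] using (hdt i).fun_pow 2
  have hexp : HasDerivAt (fun s => Real.exp (-(C + 1) * s))
      (Real.exp (-(C + 1) * t) * -(C + 1)) t := by
    simpa using ((hasDerivAt_id t).const_mul (-(C + 1))).exp
  have htime := deriv_nonneg_of_max_left ht0 (hexp.fun_mul hsum) fun s hs =>
    hmax (a := (x, s)) ⟨hx, hs.1, hs.2.trans ht.2⟩
  rw [mul_assoc, ← mul_add] at htime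
  have htime' := nonneg_of_mul_nonneg_right htime (Real.exp_pos _)
  have hp := hpde x hx t ⟨ht0, ht.2⟩ hu
  have hsplit : ∑ i, f i x t * (deriv (fun s => f i x s) t - κ * lap (fun y => f i y t) x) =
      ∑ i, f i x t * deriv (fun s => f i x s) t -
        κ * ∑ i, f i x t * lap (fun y => f i y t) x := by
    rw [Finset.mul_sum, ← Finset.sum_sub_distrib]
    exact Finset.sum_congr rfl fun i _ => by ring
  rw [hsplit] at hp
  rw [← Finset.mul_sum] at htime'
  have := mul_nonpos_of_nonneg_of_nonpos hκ.le hlap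
  linarith

theorem sPlus_quadratic {a b c : ℝ} (ha : 0 < a) (hc : 0 < c) :
    2 * c * sPlus a b c ^ 2 = b * sPlus a b c + 3 * a := by
  have h := Real.sq_sqrt (show (0 : ℝ) ≤ b ^ 2 + 24 * a * c by positivity)
  rw [sPlus]
  set d := Real.sqrt (b ^ 2 + 24 * a * c)
  field_simp
  linear_combination 2 * h

theorem sPlus_pos {a b c : ℝ} (hb : 0 < b) (hc : 0 < c) : 0 < sPlus a b c := by
  have := Real.sqrt_nonneg (b ^ 2 + 24 * a * c)
  rw [sPlus]
  positivity

theorem trace_cube_sq_le {A : Mat} (hA : A.IsSymm) (htr : A.trace = 0) :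
    6 * (A * A * A).trace ^ 2 ≤ (A * A).trace ^ 3 := by
  have hH : A.IsHermitian := by
    rw [Matrix.IsHermitian, Matrix.conjTranspose_eq_transpose_of_trivial]
    exact hA
  set U : Mat := (hH.eigenvectorUnitary : Mat)
  set D : Mat := Matrix.diagonal hH.eigenvalues
  have hU : star U * U = 1 := Unitary.coe_star_mul_self hH.eigenvectorUnitary
  have hs : A = U * D * star U := by
    have := hH.spectral_theorem
    rw [Unitary.conjStarAlgAut_apply] at this
    simpa using this
  have h2 : A * A = U * (D * D) * star U := by
    calc A * A = U * D * (star U * U) * D * star U := by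
          conv_lhs => rw [hs]
          simp only [mul_assoc]
      _ = _ := by rw [hU]; simp only [mul_assoc, one_mul]
  have h3 : A * A * A = U * (D * D * D) * star U := by
    calc A * A * A = U * (D * D) * (star U * U) * D * star U := by
          rw [h2]
          conv_lhs => rw [hs]
          simp only [mul_assoc]
      _ = _ := by rw [hU]; simp only [mul_assoc, one_mul]
  have ht : ∀ X : Mat, (U * X * star U).trace = X.trace := fun X => by
    rw [Matrix.trace_mul_comm, ← mul_assoc, hU, one_mul]
  rw [h3, h2, ht, ht]
  rw [hs, ht] at htr
  simp only [D, Matrix.diagonal_mul_diagonal, Matrix.trace_diagonal, Fin.sum_univ_three] at htr ⊢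
  generalize hH.eigenvalues 0 = x at *
  generalize hH.eigenvalues 1 = y at *
  generalize hH.eigenvalues 2 = z at *
  obtain rfl : z = -(x + y) := by linarith
  nlinarith [sq_nonneg ((x - y) * (2 * x + y) * (x + 2 * y))]

theorem mnormSq_eq_sum (A : Mat) : mnormSq A = ∑ p : Fin 3 × Fin 3, A p.1 p.2 ^ 2 := by
  simp only [mnormSq, frob, Fintype.sum_prod_type, sq]

theorem mnormSq_of_mem_NSet {a b c : ℝ} {A : Mat} (hA : A ∈ NSet a b c) :
    mnormSq A = 2 / 3 * sPlus a b c ^ 2 := by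
  obtain ⟨n, hn, rfl⟩ := hA
  simp [dotProduct, Fin.sum_univ_three] at hn
  simp [mnormSq, frob, Fin.sum_univ_three, Matrix.vecMulVec_apply, Matrix.one_apply]
  linear_combination (sPlus a b c ^ 2 * (n 0 * n 0 + n 1 * n 1 + n 2 * n 2 + 1 / 3)) * hn

theorem isSymm_of_mem_NSet {a b c : ℝ} {A : Mat} (hA : A ∈ NSet a b c) (i j : Fin 3) :
    A i j = A j i := by
  obtain ⟨n, hn, rfl⟩ := hA
  simp [Matrix.vecMulVec_apply, Matrix.one_apply, mul_comm, eq_comm]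

theorem trace_of_mem_NSet {a b c : ℝ} {A : Mat} (hA : A ∈ NSet a b c) :
    A 0 0 + A 1 1 + A 2 2 = 0 := by
  obtain ⟨n, hn, rfl⟩ := hA
  simp [dotProduct, Fin.sum_univ_three] at hn
  simp [Matrix.vecMulVec_apply]
  linear_combination sPlus a b c * hn

/-- The reaction term points inwards outside the ball of radius `√(2/3) s₊`. -/
theorem frob_Jmap_nonpos {a b c : ℝ} (ha : 0 < a) (hb : 0 < b) (hc : 0 < c) {A : Mat}
    (hA : A.IsSymm) (htr : A.trace = 0) (hN : 2 / 3 * sPlus a b c ^ 2 < mnormSq A) :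
    frob A (Jmap a b c A) ≤ 0 := by
  have hAA : (A * A).trace = mnormSq A := by
    simp only [Matrix.trace, Matrix.diag, Matrix.mul_apply, mnormSq, frob]
    exact Finset.sum_congr rfl fun i _ => Finset.sum_congr rfl fun j _ => by rw [hA.apply i j]
  have hT := trace_cube_sq_le hA htr
  rw [hAA] at hT
  have hform : frob A (Jmap a b c A) =
      (a - c * mnormSq A) * mnormSq A + b * (A * A * A).trace := by
    have h1 : frob A (A * A) = (A * A * A).trace := by
      rw [Matrix.trace_mul_comm]
      simp only [Matrix.trace, Matrix.diag, frob]
      refine Finset.sum_congr rfl fun i _ => ?_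
      rw [Matrix.mul_apply (M := A) (N := A * A)]
      refine Finset.sum_congr rfl fun j _ => ?_
      have : (A * A).IsSymm := by
        rw [Matrix.IsSymm, Matrix.transpose_mul, hA.eq]
      rw [this.apply i j]
    have h2 : frob A 1 = 0 := by
      rw [← htr]
      simp [frob, Matrix.trace, Matrix.one_apply]
    have h3 : frob A (Jmap a b c A) = (a - c * mnormSq A) * frob A A + b * frob A (A * A) -
        b / 3 * mnormSq A * frob A 1 := by
      simp only [Jmap, frob, Matrix.sub_apply, Matrix.add_apply, Matrix.smul_apply, smul_eq_mul,
        mul_sub, mul_add, Finset.sum_sub_distrib, Finset.sum_add_distrib, Finset.mul_sum]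
      simp only [mul_left_comm]
    rw [h3, h1, h2, ← mnormSq]
    ring
  rw [hform]
  set N := mnormSq A
  set T := (A * A * A).trace
  have hs := sPlus_pos (a := a) hb hc
  have hq := sPlus_quadratic (b := b) ha hc
  set s := sPlus a b c
  obtain ⟨r, hr, hrN⟩ : ∃ r : ℝ, 0 ≤ r ∧ N = 2 / 3 * r ^ 2 := by
    refine ⟨Real.sqrt (3 / 2 * N), Real.sqrt_nonneg _, ?_⟩
    rw [Real.sq_sqrt (by nlinarith [sq_nonneg s])]
    ring
  rw [hrN] at hN hT ⊢
  have hsr : s < r := lt_of_pow_lt_pow_left₀ 2 hr (by linarith)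
  have hTr : T ≤ 2 / 9 * r ^ 3 := abs_le_of_sq_le_sq' (by nlinarith) (by positivity) |>.2
  have h1 : 0 ≤ 2 * c * r ^ 2 - b * r - 3 * a := by
    have h2 : 2 * c * r ^ 2 - b * r - 3 * a = (r - s) * (2 * c * (r + s) - b) := by
      linear_combination hq
    have h3 : 0 ≤ 2 * c * (r + s) - b := by
      have : 0 ≤ (2 * c * s - b) * s := by nlinarith
      have := nonneg_of_mul_nonneg_left this hs
      nlinarith [mul_pos hc (hs.trans hsr)]
    rw [h2]
    exact mul_nonneg (by linarith) h3
  have h4 := mul_le_mul_of_nonneg_left hTr hb.le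
  nlinarith [mul_nonneg (sq_nonneg r) h1]

/-- The skew part of the reaction term is controlled by the skew part of its argument. -/
theorem skew_Jmap_le {a b c B : ℝ} (hb : 0 < b) (hc : 0 < c) {A : Mat} (hB : ∀ i j, |A i j| ≤ B) :
    ∑ i, ∑ j, (A i j - A j i) * (Jmap a b c A i j - Jmap a b c A j i) ≤
      (a + 6 * b * B) * ∑ i, ∑ j, (A i j - A j i) ^ 2 := by
  have hprod : ∀ q w w' : ℝ, |q| ≤ B → w * w' * q ≤ B * ((w ^ 2 + w' ^ 2) / 2) := by
    intro q w w' hq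
    obtain ⟨h1, h2⟩ := abs_le.mp hq
    nlinarith [mul_nonneg (sub_nonneg.mpr h2) (sq_nonneg (w + w')),
      mul_nonneg (by linarith : 0 ≤ B + q) (sq_nonneg (w - w'))]
  have hquad : ∑ i, ∑ j, (A i j - A j i) * ((A * A) i j - (A * A) j i) ≤
      6 * B * ∑ i, ∑ j, (A i j - A j i) ^ 2 := by
    have hexp : ∑ i, ∑ j, (A i j - A j i) * ((A * A) i j - (A * A) j i) =
        ∑ i, ∑ j, ∑ k, ((A i j - A j i) * (A i k - A k i) * A k j +
          (A i j - A j i) * (A k j - A j k) * A k i) := by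
      refine Finset.sum_congr rfl fun i _ => Finset.sum_congr rfl fun j _ => ?_
      rw [Matrix.mul_apply, Matrix.mul_apply, ← Finset.sum_sub_distrib, Finset.mul_sum]
      exact Finset.sum_congr rfl fun k _ => by ring
    rw [hexp]
    calc _ ≤ ∑ i, ∑ j, ∑ k, (B * (((A i j - A j i) ^ 2 + (A i k - A k i) ^ 2) / 2) +
          B * (((A i j - A j i) ^ 2 + (A k j - A j k) ^ 2) / 2)) := by
          refine Finset.sum_le_sum fun i _ => Finset.sum_le_sum fun j _ =>
            Finset.sum_le_sum fun k _ => add_le_add ?_ ?_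
          · exact hprod _ _ _ (hB k j)
          · exact hprod _ _ _ (hB k i)
      _ = _ := by
          simp only [Fin.sum_univ_three]
          ring
  have hform : ∑ i, ∑ j, (A i j - A j i) * (Jmap a b c A i j - Jmap a b c A j i) =
      (a - c * mnormSq A) * ∑ i, ∑ j, (A i j - A j i) ^ 2 +
        b * ∑ i, ∑ j, (A i j - A j i) * ((A * A) i j - (A * A) j i) := by
    simp only [Finset.mul_sum, ← Finset.sum_add_distrib]
    refine Finset.sum_congr rfl fun i _ => Finset.sum_congr rfl fun j _ => ?_
    simp only [Jmap, Matrix.sub_apply, Matrix.add_apply, Matrix.smul_apply, smul_eq_mul,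
      Matrix.one_apply, eq_comm (a := j)]
    ring
  have hN : 0 ≤ mnormSq A := by
    rw [mnormSq_eq_sum]
    positivity
  have hW : 0 ≤ ∑ i, ∑ j, (A i j - A j i) ^ 2 := by positivity
  rw [hform]
  nlinarith [mul_le_mul_of_nonneg_left hquad hb.le, mul_nonneg (mul_nonneg hc.le hN) hW]

theorem trace_Jmap {a b c : ℝ} {A : Mat} (hA : ∀ i j, A i j = A j i) :
    Jmap a b c A 0 0 + Jmap a b c A 1 1 + Jmap a b c A 2 2 =
      (a - c * mnormSq A) * (A 0 0 + A 1 1 + A 2 2) := by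
  simp only [Jmap, Matrix.sub_apply, Matrix.add_apply, Matrix.smul_apply, smul_eq_mul,
    Matrix.one_apply, Matrix.mul_apply, mnormSq, frob, Fin.sum_univ_three, hA 1 0, hA 2 0, hA 2 1]
  simp
  ring

section Flow

variable {a b c Γ L1 ε : ℝ} {Q : Vec3 → ℝ → Mat}

theorem IsSolution.contDiff_space {I : Set ℝ} (hsol : IsSolution a b c Γ L1 ε Q I) (t : ℝ)
    (i j : Fin 3) : ContDiff ℝ (⊤ : ℕ∞) fun y => Q y t i j :=
  (hsol.1 i j).comp (contDiff_id.prodMk contDiff_const)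

theorem IsSolution.differentiable_time {I : Set ℝ} (hsol : IsSolution a b c Γ L1 ε Q I) (x : Vec3)
    (i j : Fin 3) : Differentiable ℝ fun s => Q x s i j :=
  differentiable_of_smooth ((hsol.1 i j).comp (contDiff_const.prodMk contDiff_id))

/-- Symmetry is preserved by the flow. -/
theorem IsSolution.symm (hb : 0 < b) (hc : 0 < c) (hΓ : 0 < Γ) (hL1 : 0 < L1) (hε : 0 < ε)
    (hsol : IsSolution a b c Γ L1 ε Q (Set.Ici 0)) (hconst : ConstOutside a b c Q (Set.Ici 0))
    (h0 : ∀ x : Vec3, Q x 0 ∈ NSet a b c) (x : Vec3) (t : ℝ) (ht : 0 ≤ t) (i j : Fin 3) :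
    Q x t i j = Q x t j i := by
  obtain ⟨A, hA, K, hK, hout⟩ := hconst
  have hbdd : ∃ B, ∀ y ∈ K, ∀ s ∈ Set.Icc 0 t, ∀ i j, |Q y s i j| ≤ B := by
    have hcont : Continuous fun p : Vec3 × ℝ => ∑ i, ∑ j, |Q p.1 p.2 i j| := by
      have := fun i j => (hsol.1 i j).continuous
      fun_prop
    obtain ⟨B, hB⟩ := (hK.prod (isCompact_Icc (a := (0 : ℝ)) (b := t))).exists_bound_of_continuousOn
      hcont.continuousOn
    refine ⟨B, fun y hy s hs i j => le_trans ?_ ((le_abs_self _).trans (hB (y, s) ⟨hy, hs⟩))⟩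
    calc |Q y s i j| ≤ ∑ j, |Q y s i j| :=
          Finset.single_le_sum (f := fun j => |Q y s i j|) (fun _ _ => abs_nonneg _)
            (Finset.mem_univ j)
      _ ≤ ∑ i, ∑ j, |Q y s i j| :=
          Finset.single_le_sum (f := fun i => ∑ j, |Q y s i j|)
            (fun _ _ => Finset.sum_nonneg fun _ _ => abs_nonneg _) (Finset.mem_univ i)
  obtain ⟨B, hB⟩ := hbdd
  have key := sum_sq_le_of_parabolic (ι := Fin 3 × Fin 3)
    (f := fun p y s => Q y s p.1 p.2 - Q y s p.2 p.1)
    (fun p => (hsol.1 p.1 p.2).sub (hsol.1 p.2 p.1)) hK (T := t) (κ := L1 / Γ)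
    (C := 2 * (1 / (ε * Γ)) * (a + 6 * b * B)) (M := 0) (by positivity)
    (by
      intro y hy s hs
      rw [hout y hy s hs]
      simp [Fintype.sum_prod_type, Fin.sum_univ_three, isSymm_of_mem_NSet hA 1 0,
        isSymm_of_mem_NSet hA 2 0, isSymm_of_mem_NSet hA 2 1])
    (by
      intro y
      simp [Fintype.sum_prod_type, Fin.sum_univ_three, isSymm_of_mem_NSet (h0 y) 1 0,
        isSymm_of_mem_NSet (h0 y) 2 0, isSymm_of_mem_NSet (h0 y) 2 1])
    (by
      intro y hy s hs _
      have hterm : ∀ i j, deriv (fun s => Q y s i j - Q y s j i) s -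
          L1 / Γ * lap (fun z => Q z s i j - Q z s j i) y =
          1 / (ε * Γ) * (Jmap a b c (Q y s) i j - Jmap a b c (Q y s) j i) := by
        intro i j
        rw [deriv_fun_sub (hsol.differentiable_time y i j s) (hsol.differentiable_time y j i s),
          hsol.2 y s hs.1.le, hsol.2 y s hs.1.le,
          lap_sub (hsol.contDiff_space s i j) (hsol.contDiff_space s j i)]
        ring
      simp only [hterm, Fintype.sum_prod_type, sub_zero, mul_left_comm _ (1 / (ε * Γ)),
        ← Finset.mul_sum]
      have := mul_le_mul_of_nonneg_left (skew_Jmap_le (a := a) hb hc (hB y hy s ⟨hs.1.le, hs.2⟩))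
        (by positivity : 0 ≤ 1 / (ε * Γ))
      linarith) x t ⟨ht, le_rfl⟩
  have h1 := (Finset.single_le_sum (f := fun p : Fin 3 × Fin 3 =>
    (Q x t p.1 p.2 - Q x t p.2 p.1) ^ 2) (fun _ _ => sq_nonneg _)
    (Finset.mem_univ (i, j))).trans key
  exact sub_eq_zero.mp (pow_eq_zero_iff two_ne_zero |>.mp (le_antisymm h1 (sq_nonneg _)))

/-- Tracelessness is preserved by the flow. -/
theorem IsSolution.trace_eq_zero (hb : 0 < b) (hc : 0 < c) (hΓ : 0 < Γ)
    (hL1 : 0 < L1) (hε : 0 < ε)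
    (hsol : IsSolution a b c Γ L1 ε Q (Set.Ici 0)) (hconst : ConstOutside a b c Q (Set.Ici 0))
    (h0 : ∀ x : Vec3, Q x 0 ∈ NSet a b c) (x : Vec3) (t : ℝ) (ht : 0 ≤ t) :
    Q x t 0 0 + Q x t 1 1 + Q x t 2 2 = 0 := by
  have hsymm := hsol.symm hb hc hΓ hL1 hε hconst h0
  obtain ⟨A, hA, K, hK, hout⟩ := hconst
  have key := sum_sq_le_of_parabolic (ι := Unit)
    (f := fun _ y s => Q y s 0 0 + Q y s 1 1 + Q y s 2 2)
    (fun _ => ((hsol.1 0 0).add (hsol.1 1 1)).add (hsol.1 2 2)) hK (T := t) (κ := L1 / Γ)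
    (C := 2 * (1 / (ε * Γ)) * a) (M := 0) (by positivity)
    (by
      intro y hy s hs
      simp [hout y hy s hs, trace_of_mem_NSet hA])
    (by
      intro y
      simp [trace_of_mem_NSet (h0 y)])
    (by
      intro y hy s hs _
      have hd := hsol.differentiable_time y
      have hsp := hsol.contDiff_space s
      have hterm : deriv (fun s => Q y s 0 0 + Q y s 1 1 + Q y s 2 2) s -
          L1 / Γ * lap (fun z => Q z s 0 0 + Q z s 1 1 + Q z s 2 2) y =
          1 / (ε * Γ) * ((a - c * mnormSq (Q y s)) * (Q y s 0 0 + Q y s 1 1 + Q y s 2 2)) := by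
        rw [deriv_fun_add ((hd 0 0 s).fun_add (hd 1 1 s)) (hd 2 2 s),
          deriv_fun_add (hd 0 0 s) (hd 1 1 s),
          lap_add ((hsp 0 0).add (hsp 1 1)) (hsp 2 2), lap_add (hsp 0 0) (hsp 1 1),
          hsol.2 y s hs.1.le, hsol.2 y s hs.1.le, hsol.2 y s hs.1.le,
          ← trace_Jmap (hsymm y s hs.1.le)]
        ring
      simp only [hterm, Finset.univ_unique, Finset.sum_singleton, sub_zero]
      have hN : 0 ≤ mnormSq (Q y s) := by
        rw [mnormSq_eq_sum]
        positivity
      have : 0 ≤ 1 / (ε * Γ) * (c * mnormSq (Q y s) *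
        (Q y s 0 0 + Q y s 1 1 + Q y s 2 2) ^ 2) := by positivity
      linarith) x t ⟨ht, le_rfl⟩
  simp only [Finset.univ_unique, Finset.sum_singleton] at key
  exact pow_eq_zero_iff two_ne_zero |>.mp (le_antisymm key (sq_nonneg _))

end Flow

/-- Maximum principle: for a classical solution of the relaxed Q-tensor flow on
`ℝ³ × [0,∞)`, constant outside a compact set, with initial data in `𝒩`,
`|Q(x,t)| ≤ √(2/3) s₊` for all `x` and `t ≥ 0`. -/
theorem maximum_principle
    (a b c Γ L1 ε : ℝ) (ha : 0 < a) (hb : 0 < b) (hc : 0 < c)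
    (hΓ : 0 < Γ) (hL1 : 0 < L1) (hε : 0 < ε)
    (Q : Vec3 → ℝ → Mat)
    (hsol : IsSolution a b c Γ L1 ε Q (Set.Ici 0))
    (hconst : ConstOutside a b c Q (Set.Ici 0))
    (h0 : ∀ x : Vec3, Q x 0 ∈ NSet a b c) :
    ∀ (x : Vec3) (t : ℝ), 0 ≤ t →
      Real.sqrt (mnormSq (Q x t)) ≤ Real.sqrt (2 / 3) * sPlus a b c := by
  intro x t ht
  have hsymm := hsol.symm hb hc hΓ hL1 hε hconst h0
  have htr := hsol.trace_eq_zero hb hc hΓ hL1 hε hconst h0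
  obtain ⟨A, hA, K, hK, hout⟩ := hconst
  have key := sum_sq_le_of_parabolic (ι := Fin 3 × Fin 3) (f := fun p y s => Q y s p.1 p.2)
    (fun p => hsol.1 p.1 p.2) hK (T := t) (κ := L1 / Γ) (C := 0)
    (M := 2 / 3 * sPlus a b c ^ 2) (by positivity)
    (fun y hy s hs => by
      rw [← mnormSq_eq_sum, hout y hy s hs, mnormSq_of_mem_NSet hA])
    (fun y => by rw [← mnormSq_eq_sum, mnormSq_of_mem_NSet (h0 y)])
    (by
      intro y hy s hs hlt
      rw [← mnormSq_eq_sum] at hlt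
      have hJ := frob_Jmap_nonpos ha hb hc (A := Q y s)
        (Matrix.IsSymm.ext fun i j => hsymm y s hs.1.le j i)
        (by simpa [Matrix.trace, Fin.sum_univ_three] using htr y s hs.1.le) hlt
      simp only [hsol.2 y s hs.1.le, add_sub_cancel_right, Fintype.sum_prod_type, zero_mul,
        mul_left_comm _ (1 / (ε * Γ)), ← Finset.mul_sum]
      have := mul_nonpos_of_nonneg_of_nonpos (by positivity : 0 ≤ 1 / (ε * Γ)) hJ
      rw [frob] at this
      linarith) x t ⟨ht, le_rfl⟩
  rw [← mnormSq_eq_sum] at key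
  calc Real.sqrt (mnormSq (Q x t)) ≤ Real.sqrt (2 / 3 * sPlus a b c ^ 2) := Real.sqrt_le_sqrt key
    _ = Real.sqrt (2 / 3) * sPlus a b c := by
      rw [Real.sqrt_mul (by norm_num), Real.sqrt_sq (sPlus_pos hb hc).le]
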